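/- Away from the fiber surface the regularized and classical slender-body velocities agree to order δ²: let 0 < α < 1 and let x = X(s) + ε^{1−α} e_ρ(s,θ) be a fluid point at distance ε^{1−α} from the centerline (assumed uniquely representable in the fiber frame). There exist constants C > 0 and ε₀ > 0, depending only on c_Γ and κ_max, such that for all 0 < ε < ε₀, 0 < δ < ε₀, and every continuous f : ℝ/ℤ → ℝ³, |u^δ(x) − u^SB(x)| ≤ C (δ²/ε^{2(1−α)}) ‖f‖_{C⁰}. In particular, for δ proportional to ε this difference is O(ε^{2α}). -/

import Mathlib

open MeasureTheory

noncomputable section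

local notation "⟪" x ", " y "⟫" => @inner ℝ _ _ x y

abbrev V3 : Type := EuclideanSpace ℝ (Fin 3)

/-- The `C⁰` (sup) norm of a function `ℝ/ℤ → ℝ³`. -/
def C0norm (f : ℝ → V3) : ℝ := ⨆ s : ℝ, ‖f s‖

/-- The `C¹` norm of a function `ℝ/ℤ → ℝ³`. -/
def C1norm (f : ℝ → V3) : ℝ := C0norm f + C0norm (deriv f)

/-- The radial unit vector `e_ρ(s,θ) = cos θ e_{n1}(s) + sin θ e_{n2}(s)`. -/
def ePerp (en1 en2 : ℝ → V3) (s θ : ℝ) : V3 :=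
  Real.cos θ • en1 s + Real.sin θ • en2 s

/-- `R(s, s̄, θ) = X(s) + ε e_ρ(s,θ) − X(s − s̄)`. -/
def Rvec (X en1 en2 : ℝ → V3) (ε s sb θ : ℝ) : V3 :=
  X s + ε • ePerp en1 en2 s θ - X (s - sb)

/-- The slender-body geometry hypotheses: `X : ℝ/ℤ → ℝ³` is a `C²` closed curve
parameterized by arclength, non-self-intersecting with constant `cΓ`, with curvature
bounded by `κmax`, together with a `C¹` orthonormal frame `(X', en1, en2)`. -/
structure SlenderGeom (cΓ κmax : ℝ) (X en1 en2 : ℝ → V3) : Prop where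
  smooth : ContDiff ℝ 2 X
  periodicX : ∀ s, X (s + 1) = X s
  arclength : ∀ s, ‖deriv X s‖ = 1
  no_self_intersect : ∀ s t : ℝ, |s - t| ≤ 1 / 2 → cΓ * |s - t| ≤ ‖X s - X t‖
  curvature_max : ∀ s, ‖deriv (deriv X) s‖ ≤ κmax
  en1_smooth : ContDiff ℝ 1 en1
  en2_smooth : ContDiff ℝ 1 en2
  en1_periodic : ∀ s, en1 (s + 1) = en1 s
  en2_periodic : ∀ s, en2 (s + 1) = en2 s
  en1_unit : ∀ s, ‖en1 s‖ = 1
  en2_unit : ∀ s, ‖en2 s‖ = 1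
  es_en1 : ∀ s, ⟪deriv X s, en1 s⟫ = 0
  es_en2 : ∀ s, ⟪deriv X s, en2 s⟫ = 0
  en1_en2 : ∀ s, ⟪en1 s, en2 s⟫ = 0

/-- The singular Stokeslet `S(y) v = v/|y| + (y·v) y/|y|³`. -/
def stokeslet (y v : V3) : V3 := ‖y‖⁻¹ • v + (‖y‖ ^ 3)⁻¹ • ⟪y, v⟫ • y

/-- The singular doublet `D(y) v = v/|y|³ − 3 (y·v) y/|y|⁵`. -/
def doubletK (y v : V3) : V3 := (‖y‖ ^ 3)⁻¹ • v - (3 * (‖y‖ ^ 5)⁻¹) • ⟪y, v⟫ • y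

/-- The regularized Stokeslet `S_δ(y) v`. -/
def stokesletReg (δ : ℝ) (y v : V3) : V3 :=
  ((‖y‖ ^ 2 + δ ^ 2) ^ ((1 : ℝ) / 2))⁻¹ • v
    + ((‖y‖ ^ 2 + δ ^ 2) ^ ((3 : ℝ) / 2))⁻¹ • (⟪y, v⟫ • y + δ ^ 2 • v)

/-- The regularized doublet `D_δ(y) v`. -/
def doubletReg (δ : ℝ) (y v : V3) : V3 :=
  ((‖y‖ ^ 2 + δ ^ 2) ^ ((3 : ℝ) / 2))⁻¹ • v
    - (3 * ((‖y‖ ^ 2 + δ ^ 2) ^ ((5 : ℝ) / 2))⁻¹) • (⟪y, v⟫ • y + δ ^ 2 • v)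

/-- The classical slender-body velocity `u^SB(x)` with doublet coefficient `ε²/2`. -/
def uSB (X f : ℝ → V3) (ε : ℝ) (x : V3) : V3 :=
  (8 * Real.pi)⁻¹ • ∫ t in (0:ℝ)..1,
    (stokeslet (x - X t) (f t) + (ε ^ 2 / 2) • doubletK (x - X t) (f t))

/-- The regularized slender-body velocity with doublet coefficient `β`. -/
def uReg (X f : ℝ → V3) (β δ : ℝ) (x : V3) : V3 :=
  (8 * Real.pi)⁻¹ • ∫ t in (0:ℝ)..1,
    (stokesletReg δ (x - X t) (f t) + β • doubletReg δ (x - X t) (f t))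

/-- The Keller–Rubinow classical centerline velocity `u^SB_C(X(s))`. -/
def uSBC (X f : ℝ → V3) (ε s : ℝ) : V3 :=
  (8 * Real.pi)⁻¹ •
    ((f s - (3 : ℝ) • ⟪deriv X s, f s⟫ • deriv X s
        - (2 * Real.log (Real.pi * ε / 4)) • (f s + ⟪deriv X s, f s⟫ • deriv X s))
      + ∫ t in (0:ℝ)..1,
          ((‖X s - X t‖⁻¹ • f t
              + (‖X s - X t‖ ^ 3)⁻¹ • ⟪X s - X t, f t⟫ • (X s - X t))
            - |Real.sin (Real.pi * (s - t)) / Real.pi|⁻¹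
                • (f s + ⟪deriv X s, f s⟫ • deriv X s)))

/-- The regularized pressure `p^δ(x)`. -/
def pReg (X f : ℝ → V3) (δ : ℝ) (x : V3) : ℝ :=
  (4 * Real.pi)⁻¹ * ∫ t in (0:ℝ)..1,
    (⟪x - X t, f t⟫ * ((‖x - X t‖ ^ 2 + δ ^ 2) ^ ((3 : ℝ) / 2))⁻¹
      + 3 * δ ^ 2 * ⟪x - X t, f t⟫ * (2 * (‖x - X t‖ ^ 2 + δ ^ 2) ^ ((5 : ℝ) / 2))⁻¹)

/-- The symmetric strain tensor `E(u) = (∇u + (∇u)ᵀ)/2` applied to the vector `n`. -/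
def strainApply (u : V3 → V3) (x n : V3) : V3 :=
  (2 : ℝ)⁻¹ • (fderiv ℝ u x n + gradient (fun y => ⟪u y, n⟫) x)

/-- The surface Jacobian `J_ε(s,θ) = ε(1 − ε(κ₁ cos θ + κ₂ sin θ))`. -/
def Jfac (X en1 en2 : ℝ → V3) (ε s θ : ℝ) : ℝ :=
  ε * (1 - ε * (⟪deriv (deriv X) s, en1 s⟫ * Real.cos θ
      + ⟪deriv (deriv X) s, en2 s⟫ * Real.sin θ))

/-- The regularized surface force density
`f^δ(s) = ∫_0^{2π} (2 E(u^δ) n − p^δ n) J_ε dθ`, with `n = −e_ρ`. -/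
def fReg (X en1 en2 f : ℝ → V3) (ε δ s : ℝ) : V3 :=
  ∫ θ in (0:ℝ)..(2 * Real.pi),
    Jfac X en1 en2 ε s θ •
      ((2 : ℝ) • strainApply (uReg X f ((ε ^ 2 + δ ^ 2) / 2) δ)
          (X s + ε • ePerp en1 en2 s θ) (-ePerp en1 en2 s θ)
        - pReg X f δ (X s + ε • ePerp en1 en2 s θ) • (-ePerp en1 en2 s θ))

/-- The vector field `d_n^δ[f](x)`. -/
def dReg (X f : ℝ → V3) (δ : ℝ) (n : ℕ) (x : V3) : V3 :=
  (8 * Real.pi)⁻¹ • ∫ t in (0:ℝ)..1,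
    (δ ^ 2 * ((‖x - X t‖ ^ 2 + δ ^ 2) ^ ((n : ℝ) / 2))⁻¹) • f t

/-- The scalar field `d_5^δ[f·R](x)`. -/
def dRegP (X f : ℝ → V3) (δ : ℝ) (x : V3) : ℝ :=
  (8 * Real.pi)⁻¹ * ∫ t in (0:ℝ)..1,
    δ ^ 2 * ⟪x - X t, f t⟫ * ((‖x - X t‖ ^ 2 + δ ^ 2) ^ ((5 : ℝ) / 2))⁻¹

/-- The extra force contribution
`F^δ(s) = ∫_0^{2π} (2E(d₃^δ[f])n − 3(ε²+δ²)E(d₅^δ[f])n − 3 d₅^δ[f·R] n) J_ε dθ`. -/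
def Fextra (X en1 en2 f : ℝ → V3) (ε δ s : ℝ) : V3 :=
  ∫ θ in (0:ℝ)..(2 * Real.pi),
    Jfac X en1 en2 ε s θ •
      ((2 : ℝ) • strainApply (dReg X f δ 3) (X s + ε • ePerp en1 en2 s θ)
          (-ePerp en1 en2 s θ)
        - (3 * (ε ^ 2 + δ ^ 2)) • strainApply (dReg X f δ 5)
            (X s + ε • ePerp en1 en2 s θ) (-ePerp en1 en2 s θ)
        - (3 * dRegP X f δ (X s + ε • ePerp en1 en2 s θ)) • (-ePerp en1 en2 s θ))

/-- Values of a continuous `1`-periodic function are bounded by its `C⁰` norm. -/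
theorem norm_le_C0norm {f : ℝ → V3} (hf : Continuous f) (hper : ∀ s, f (s + 1) = f s) (t : ℝ) :
    ‖f t‖ ≤ C0norm f := by
  have hp : Function.Periodic (fun s => ‖f s‖) 1 := fun s => by simp [hper s]
  have hb : BddAbove (Set.range fun s => ‖f s‖) := by
    have h := hp.compact_of_continuous one_ne_zero hf.norm
    exact h.bddAbove
  exact le_ciSup hb t

/-- The radial vector of an orthonormal frame is a unit vector. -/
theorem norm_ePerp {en1 en2 : ℝ → V3} {s : ℝ} (h1 : ‖en1 s‖ = 1) (h2 : ‖en2 s‖ = 1)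
    (h12 : ⟪en1 s, en2 s⟫ = 0) (θ : ℝ) : ‖ePerp en1 en2 s θ‖ = 1 := by
  have h : ‖ePerp en1 en2 s θ‖ ^ 2 = 1 := by
    rw [ePerp, norm_add_sq_real, real_inner_smul_left, real_inner_smul_right, h12, norm_smul,
      norm_smul, h1, h2]
    simp
  nlinarith [norm_nonneg (ePerp en1 en2 s θ)]

/-- Elementary estimates comparing `a = 1/R` with `b = (R² + δ²)^{-1/2}`. -/
theorem inv_sub_inv_reg_bounds {a b δ : ℝ} (hb : 0 < b) (hba : b ≤ a)
    (h : a ^ 2 - b ^ 2 = a ^ 2 * b ^ 2 * δ ^ 2) :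
    a - b ≤ δ ^ 2 * a ^ 3 ∧ a ^ 3 - b ^ 3 ≤ 3 * δ ^ 2 * a ^ 5 ∧
      a ^ 5 - b ^ 5 ≤ 5 * δ ^ 2 * a ^ 7 := by
  have ha : 0 < a := hb.trans_le hba
  have h1 : a - b ≤ δ ^ 2 * a ^ 3 := by
    have e : (a - b) * (a + b) ≤ δ ^ 2 * a ^ 3 * (a + b) := by
      have : a ^ 2 * b ^ 2 * δ ^ 2 ≤ a ^ 2 * a ^ 2 * δ ^ 2 := by gcongr
      have : 0 ≤ δ ^ 2 * a ^ 3 * b := by positivity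
      nlinarith
    exact le_of_mul_le_mul_right e (by positivity)
  have hd : 0 ≤ a - b := sub_nonneg.2 hba
  refine ⟨h1, ?_, ?_⟩
  · calc a ^ 3 - b ^ 3 = (a - b) * (a ^ 2 + a * b + b ^ 2) := by ring
      _ ≤ (δ ^ 2 * a ^ 3) * (a ^ 2 + a * a + a ^ 2) := by gcongr
      _ = _ := by ring
  · calc a ^ 5 - b ^ 5
        = (a - b) * (a ^ 4 + a ^ 3 * b + a ^ 2 * b ^ 2 + a * b ^ 3 + b ^ 4) := by ring
      _ ≤ (δ ^ 2 * a ^ 3) * (a ^ 4 + a ^ 3 * a + a ^ 2 * a ^ 2 + a * a ^ 3 + a ^ 4) := by gcongr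
      _ = _ := by ring

/-- Pointwise difference of the regularized and classical slender-body kernels. -/
theorem norm_kernelReg_sub_kernel_le {ε δ : ℝ} {y : V3} (v : V3) (hy : 0 < ‖y‖) (hε : 0 ≤ ε)
    (hεy : ε ≤ ‖y‖) :
    ‖(stokesletReg δ y v + ((ε ^ 2 + δ ^ 2) / 2) • doubletReg δ y v)
        - (stokeslet y v + (ε ^ 2 / 2) • doubletK y v)‖
      ≤ 19 * δ ^ 2 * (‖y‖ ^ 3)⁻¹ * ‖v‖ := by
  set R := ‖y‖ with hR
  set T := R ^ 2 + δ ^ 2 with hT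
  have hT0 : 0 < T := by positivity
  obtain ⟨a, ha⟩ : ∃ a, a = R⁻¹ := ⟨_, rfl⟩
  obtain ⟨b, hb⟩ : ∃ b, b = (T ^ ((1 : ℝ) / 2))⁻¹ := ⟨_, rfl⟩
  have ha0 : 0 < a := by rw [ha]; positivity
  have hb0 : 0 < b := by rw [hb]; positivity
  have hb3 : (T ^ ((3 : ℝ) / 2))⁻¹ = b ^ 3 := by
    rw [hb, inv_pow, ← Real.rpow_natCast, ← Real.rpow_mul hT0.le]; norm_num
  have hb5 : (T ^ ((5 : ℝ) / 2))⁻¹ = b ^ 5 := by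
    rw [hb, inv_pow, ← Real.rpow_natCast, ← Real.rpow_mul hT0.le]; norm_num
  have hb2 : b ^ 2 * T = 1 := by
    have : b ^ 2 = T⁻¹ := by
      rw [hb, inv_pow, ← Real.rpow_natCast, ← Real.rpow_mul hT0.le]; norm_num
    rw [this]; field_simp
  have haR : a * R = 1 := by rw [ha]; field_simp
  have hbδ : b ^ 2 * δ ^ 2 ≤ 1 := by
    have : 0 ≤ b ^ 2 * R ^ 2 := by positivity
    nlinarith
  have haε : ε ^ 2 * a ^ 2 ≤ 1 := by
    have : ε * a ≤ 1 := by rw [← haR, mul_comm a]; gcongr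
    have h0 : 0 ≤ ε * a := by positivity
    nlinarith
  have hab : a ^ 2 - b ^ 2 = a ^ 2 * b ^ 2 * δ ^ 2 := by
    have e1 : a ^ 2 * R ^ 2 = 1 := by rw [← mul_pow, haR, one_pow]
    have e2 : δ ^ 2 = T - R ^ 2 := by rw [hT]; ring
    rw [e2]
    linear_combination b ^ 2 * e1 - a ^ 2 * hb2
  have hba : b ≤ a := by
    have : 0 ≤ a ^ 2 * b ^ 2 * δ ^ 2 := by positivity
    nlinarith
  obtain ⟨d1, d3, d5⟩ := inv_sub_inv_reg_bounds hb0 hba hab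
  have p3 : b ^ 3 ≤ a ^ 3 := by gcongr
  have p5 : b ^ 5 ≤ a ^ 5 := by gcongr
  set P := (b - a) + δ ^ 2 * b ^ 3 + (ε ^ 2 + δ ^ 2) / 2 * (b ^ 3 - 3 * b ^ 5 * δ ^ 2)
    - ε ^ 2 / 2 * a ^ 3 with hP
  set Q := (b ^ 3 - a ^ 3) - 3 * ((ε ^ 2 + δ ^ 2) / 2) * b ^ 5 + 3 * (ε ^ 2 / 2) * a ^ 5 with hQ
  have key : (stokesletReg δ y v + ((ε ^ 2 + δ ^ 2) / 2) • doubletReg δ y v)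
        - (stokeslet y v + (ε ^ 2 / 2) • doubletK y v) = P • v + Q • ⟪y, v⟫ • y := by
    simp only [stokesletReg, doubletReg, stokeslet, doubletK]
    rw [← hR, ← hT, hb3, hb5, ← hb, ← inv_pow, ← inv_pow, ← ha, hP, hQ]
    module
  have b1 : ε ^ 2 * (a ^ 3 - b ^ 3) ≤ 3 * δ ^ 2 * a ^ 3 := by
    calc ε ^ 2 * (a ^ 3 - b ^ 3) ≤ ε ^ 2 * (3 * δ ^ 2 * a ^ 5) := by gcongr
      _ = (ε ^ 2 * a ^ 2) * (3 * δ ^ 2 * a ^ 3) := by ring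
      _ ≤ 1 * (3 * δ ^ 2 * a ^ 3) := by gcongr
      _ = _ := by ring
  have b2 : ε ^ 2 * (a ^ 5 - b ^ 5) ≤ 5 * δ ^ 2 * a ^ 5 := by
    calc ε ^ 2 * (a ^ 5 - b ^ 5) ≤ ε ^ 2 * (5 * δ ^ 2 * a ^ 7) := by gcongr
      _ = (ε ^ 2 * a ^ 2) * (5 * δ ^ 2 * a ^ 5) := by ring
      _ ≤ 1 * (5 * δ ^ 2 * a ^ 5) := by gcongr
      _ = _ := by ring
  have b3 : ε ^ 2 * (b ^ 5 * δ ^ 2) ≤ δ ^ 2 * a ^ 3 := by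
    calc ε ^ 2 * (b ^ 5 * δ ^ 2) ≤ ε ^ 2 * (a ^ 5 * δ ^ 2) := by gcongr
      _ = (ε ^ 2 * a ^ 2) * (δ ^ 2 * a ^ 3) := by ring
      _ ≤ 1 * (δ ^ 2 * a ^ 3) := by gcongr
      _ = _ := by ring
  have b4 : δ ^ 2 * (b ^ 5 * δ ^ 2) ≤ δ ^ 2 * a ^ 3 := by
    calc δ ^ 2 * (b ^ 5 * δ ^ 2) = (b ^ 2 * δ ^ 2) * (δ ^ 2 * b ^ 3) := by ring
      _ ≤ 1 * (δ ^ 2 * a ^ 3) := by gcongr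
      _ = _ := by ring
  have b5 : δ ^ 2 * b ^ 3 ≤ δ ^ 2 * a ^ 3 := by gcongr
  have b6 : δ ^ 2 * b ^ 5 ≤ δ ^ 2 * a ^ 5 := by gcongr
  have n1 : 0 ≤ ε ^ 2 * (a ^ 3 - b ^ 3) := mul_nonneg (sq_nonneg _) (sub_nonneg.2 p3)
  have n2 : 0 ≤ ε ^ 2 * (a ^ 5 - b ^ 5) := mul_nonneg (sq_nonneg _) (sub_nonneg.2 p5)
  have n3 : 0 ≤ ε ^ 2 * (b ^ 5 * δ ^ 2) := by positivity
  have n4 : 0 ≤ δ ^ 2 * (b ^ 5 * δ ^ 2) := by positivity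
  have n5 : 0 ≤ δ ^ 2 * b ^ 3 := by positivity
  have n6 : 0 ≤ δ ^ 2 * b ^ 5 := by positivity
  have hPb : |P| ≤ 7 * δ ^ 2 * a ^ 3 := by
    rw [abs_le, hP]; constructor <;> linarith
  have hQb : |Q| ≤ 12 * δ ^ 2 * a ^ 5 := by
    rw [abs_le, hQ]; constructor <;> linarith
  rw [key]
  calc ‖P • v + Q • ⟪y, v⟫ • y‖ ≤ |P| * ‖v‖ + |Q| * (|⟪y, v⟫| * R) := by
        refine (norm_add_le _ _).trans_eq ?_
        rw [norm_smul, norm_smul, norm_smul]; simp only [Real.norm_eq_abs, ← hR]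
    _ ≤ (7 * δ ^ 2 * a ^ 3) * ‖v‖ + (12 * δ ^ 2 * a ^ 5) * ((R * ‖v‖) * R) := by
        gcongr
        exact abs_real_inner_le_norm y v
    _ = (7 * δ ^ 2 * a ^ 3) * ‖v‖ + (12 * δ ^ 2 * a ^ 3) * (a * R) ^ 2 * ‖v‖ := by ring
    _ = 19 * δ ^ 2 * (R ^ 3)⁻¹ * ‖v‖ := by rw [haR, ha, inv_pow]; ring

theorem integral_inv_sq_add_sq_le {c r : ℝ} (hc : 0 < c) (hr : 0 < r) (s : ℝ) :
    ∫ t in (s - 1 / 2)..(s + 1 / 2), (r ^ 2 + (c * (t - s) / 2) ^ 2)⁻¹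
      ≤ 2 * Real.pi / (c * r) := by
  have hd : ∀ t ∈ Set.uIcc (s - 1 / 2) (s + 1 / 2),
      HasDerivAt (fun t => 2 / (c * r) * Real.arctan (c * (t - s) / (2 * r)))
        (r ^ 2 + (c * (t - s) / 2) ^ 2)⁻¹ t := by
    intro t _
    have h := (((((hasDerivAt_id t).sub_const s).const_mul c).div_const (2 * r)).arctan).const_mul
      (2 / (c * r))
    refine h.congr_deriv ?_
    simp only [id]
    have h1 : (1 + (c * (t - s) / (2 * r)) ^ 2) ≠ 0 := by positivity
    have h3 : r ^ 2 + (c * (t - s) / 2) ^ 2 = r ^ 2 * (1 + (c * (t - s) / (2 * r)) ^ 2) := by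
      field_simp
    rw [h3]
    field_simp
  have hcont : Continuous fun t : ℝ => (r ^ 2 + (c * (t - s) / 2) ^ 2)⁻¹ :=
    Continuous.inv₀ (by fun_prop) fun t => by positivity
  rw [intervalIntegral.integral_eq_sub_of_hasDerivAt hd (hcont.intervalIntegrable _ _),
    ← mul_sub]
  calc _ ≤ 2 / (c * r) * Real.pi := by
        gcongr
        linarith [Real.arctan_lt_pi_div_two (c * (s + 1 / 2 - s) / (2 * r)),
          Real.neg_pi_div_two_lt_arctan (c * (s - 1 / 2 - s) / (2 * r))]
    _ = _ := by ring

/-- Along a non-self-intersecting closed curve, `∫ |x - X(t)|⁻³ dt = O(r⁻²)` when `x` is at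
distance `r` from the curve. -/
theorem integral_inv_dist_cube_le {X : ℝ → V3} {c r s : ℝ} {x : V3} (hc : 0 < c) (hr : 0 < r)
    (hX : Continuous X) (hper : ∀ s, X (s + 1) = X s)
    (hinj : ∀ s t : ℝ, |s - t| ≤ 1 / 2 → c * |s - t| ≤ ‖X s - X t‖)
    (hxs : ‖x - X s‖ ≤ r) (hx : ∀ t, r ≤ ‖x - X t‖) :
    ∫ t in (0:ℝ)..1, (‖x - X t‖ ^ 3)⁻¹ ≤ 4 * Real.pi / (c * r ^ 2) := by
  have hpos : ∀ t, 0 < ‖x - X t‖ := fun t => hr.trans_le (hx t)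
  have hcont : Continuous fun t => (‖x - X t‖ ^ 3)⁻¹ :=
    Continuous.inv₀ (by fun_prop) fun t => (pow_pos (hpos t) 3).ne'
  have hp : Function.Periodic (fun t => (‖x - X t‖ ^ 3)⁻¹) 1 := fun t => by simp [hper t]
  have hshift := hp.intervalIntegral_add_eq 0 (s - 1 / 2)
  rw [zero_add, show s - 1 / 2 + 1 = s + 1 / 2 by ring] at hshift
  rw [hshift]
  have hcont' : Continuous fun t : ℝ => 2 / r * (r ^ 2 + (c * (t - s) / 2) ^ 2)⁻¹ :=
    continuous_const.mul (Continuous.inv₀ (by fun_prop) fun t => by positivity)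
  calc ∫ t in (s - 1 / 2)..(s + 1 / 2), (‖x - X t‖ ^ 3)⁻¹
      ≤ ∫ t in (s - 1 / 2)..(s + 1 / 2), 2 / r * (r ^ 2 + (c * (t - s) / 2) ^ 2)⁻¹ := by
        refine intervalIntegral.integral_mono_on (by linarith) (hcont.intervalIntegrable _ _)
          (hcont'.intervalIntegrable _ _) fun t ht => ?_
        have hst : |s - t| ≤ 1 / 2 := by rw [abs_le]; constructor <;> linarith [ht.1, ht.2]
        have h1 := hinj s t hst
        have h2 : ‖X s - X t‖ ≤ ‖x - X t‖ + ‖x - X s‖ := by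
          rw [show X s - X t = (x - X t) - (x - X s) by abel]; exact norm_sub_le _ _
        have hR := hx t
        have h3 : c * |s - t| / 2 ≤ ‖x - X t‖ := by linarith
        have h4 : (c * (t - s) / 2) ^ 2 ≤ ‖x - X t‖ ^ 2 := by
          rw [show (c * (t - s) / 2) ^ 2 = (c * |s - t| / 2) ^ 2 by
            rw [div_pow, mul_pow, div_pow, mul_pow, sq_abs]; ring]
          gcongr
        rw [← div_eq_mul_inv, div_div, inv_eq_one_div, div_le_div_iff₀ (pow_pos (hpos t) 3)
          (by positivity)]
        calc 1 * (r * (r ^ 2 + (c * (t - s) / 2) ^ 2))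
            ≤ 1 * (‖x - X t‖ * (‖x - X t‖ ^ 2 + ‖x - X t‖ ^ 2)) := by gcongr
          _ = 2 * ‖x - X t‖ ^ 3 := by ring
    _ ≤ 2 / r * (2 * Real.pi / (c * r)) := by
        rw [intervalIntegral.integral_const_mul]
        gcongr
        exact integral_inv_sq_add_sq_le hc hr s
    _ = _ := by field_simp; ring

/-- The difference of the regularized and classical velocities at distance `r ≥ ε` from the
centerline. -/
theorem norm_uReg_sub_uSB_le {X f : ℝ → V3} {c r s ε δ : ℝ} {x : V3} (hc : 0 < c) (hr : 0 < r)
    (hε : 0 ≤ ε) (hεr : ε ≤ r) (hX : Continuous X) (hXper : ∀ s, X (s + 1) = X s)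
    (hinj : ∀ s t : ℝ, |s - t| ≤ 1 / 2 → c * |s - t| ≤ ‖X s - X t‖)
    (hf : Continuous f) (hfper : ∀ s, f (s + 1) = f s)
    (hxs : ‖x - X s‖ ≤ r) (hx : ∀ t, r ≤ ‖x - X t‖) :
    ‖uReg X f ((ε ^ 2 + δ ^ 2) / 2) δ x - uSB X f ε x‖
      ≤ 19 / (2 * c) * (δ ^ 2 / r ^ 2) * C0norm f := by
  have hpos : ∀ t, 0 < ‖x - X t‖ := fun t => hr.trans_le (hx t)
  have hne : ∀ t, ‖x - X t‖ ≠ 0 := fun t => (hpos t).ne'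
  have hT : ∀ t, 0 < ‖x - X t‖ ^ 2 + δ ^ 2 := fun t => by have := hpos t; positivity
  have hpow : ∀ p : ℝ, Continuous fun t => ((‖x - X t‖ ^ 2 + δ ^ 2) ^ p)⁻¹ := fun p =>
    Continuous.inv₀ (Continuous.rpow_const (by fun_prop) fun t => Or.inl (hT t).ne')
      fun t => (Real.rpow_pos_of_pos (hT t) p).ne'
  have hinv : ∀ n : ℕ, Continuous fun t => (‖x - X t‖ ^ n)⁻¹ := fun n =>
    Continuous.inv₀ (by fun_prop) fun t => pow_ne_zero n (hne t)
  have hinv1 : Continuous fun t => ‖x - X t‖⁻¹ := by simpa using hinv 1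
  have c1 : Continuous fun t => stokesletReg δ (x - X t) (f t)
      + ((ε ^ 2 + δ ^ 2) / 2) • doubletReg δ (x - X t) (f t) := by
    have h1 := hpow (1 / 2)
    have h3 := hpow (3 / 2)
    have h5 := hpow (5 / 2)
    unfold stokesletReg doubletReg
    fun_prop
  have c2 : Continuous fun t => stokeslet (x - X t) (f t)
      + (ε ^ 2 / 2) • doubletK (x - X t) (f t) := by
    have h3 := hinv 3
    have h5 := hinv 5
    unfold stokeslet doubletK
    fun_prop
  have hM : 0 ≤ C0norm f := (norm_nonneg _).trans (norm_le_C0norm hf hfper 0)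
  have hint : ‖∫ t in (0:ℝ)..1, ((stokesletReg δ (x - X t) (f t)
      + ((ε ^ 2 + δ ^ 2) / 2) • doubletReg δ (x - X t) (f t))
        - (stokeslet (x - X t) (f t) + (ε ^ 2 / 2) • doubletK (x - X t) (f t)))‖
      ≤ ∫ t in (0:ℝ)..1, 19 * δ ^ 2 * C0norm f * (‖x - X t‖ ^ 3)⁻¹ := by
    refine intervalIntegral.norm_integral_le_of_norm_le zero_le_one
      (Filter.Eventually.of_forall fun t _ => ?_)
      ((continuous_const.mul (hinv 3)).intervalIntegrable _ _)
    calc _ ≤ 19 * δ ^ 2 * (‖x - X t‖ ^ 3)⁻¹ * ‖f t‖ :=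
          norm_kernelReg_sub_kernel_le (f t) (hpos t) hε (hεr.trans (hx t))
      _ ≤ 19 * δ ^ 2 * (‖x - X t‖ ^ 3)⁻¹ * C0norm f := by
          gcongr
          exact norm_le_C0norm hf hfper t
      _ = _ := by ring
  rw [uReg, uSB, ← smul_sub, ← intervalIntegral.integral_sub (c1.intervalIntegrable _ _)
    (c2.intervalIntegrable _ _), norm_smul, Real.norm_of_nonneg (by positivity)]
  rw [intervalIntegral.integral_const_mul] at hint
  calc _ ≤ (8 * Real.pi)⁻¹ * (19 * δ ^ 2 * C0norm f * (4 * Real.pi / (c * r ^ 2))) := by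
        gcongr
        refine hint.trans ?_
        gcongr
        exact integral_inv_dist_cube_le hc hr hX hXper hinj hxs hx
    _ = _ := by
        have := Real.pi_ne_zero
        field_simp
        ring

/-- At a fluid point `x = X(s) + ε^{1−α} e_ρ(s,θ)` (at distance `ε^{1−α}`
from the centerline, uniquely representable in the fiber frame), the regularized and
classical slender-body velocities satisfy `|u^δ(x) − u^SB(x)| ≤ C δ²/ε^{2(1−α)} ‖f‖_{C⁰}`. -/
theorem bulk_decay_estimate (cΓ κmax : ℝ) (hcΓ : 0 < cΓ) :
    ∃ C > 0, ∃ ε₀ > 0,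
      ∀ X en1 en2 : ℝ → V3, SlenderGeom cΓ κmax X en1 en2 →
      ∀ ε δ : ℝ, 0 < ε → ε < ε₀ → 0 < δ → δ < ε₀ →
      ∀ α : ℝ, 0 < α → α < 1 → ε ^ ((1 : ℝ) - α) < ε₀ →
      ∀ f : ℝ → V3, Continuous f → (∀ s, f (s + 1) = f s) →
      ∀ s θ : ℝ,
        -- unique representability: `X(s)` is a closest centerline point to `x`
        (∀ t : ℝ, ε ^ ((1 : ℝ) - α)
            ≤ ‖X s + ε ^ ((1 : ℝ) - α) • ePerp en1 en2 s θ - X t‖) →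
        ‖uReg X f ((ε ^ 2 + δ ^ 2) / 2) δ (X s + ε ^ ((1 : ℝ) - α) • ePerp en1 en2 s θ)
            - uSB X f ε (X s + ε ^ ((1 : ℝ) - α) • ePerp en1 en2 s θ)‖
          ≤ C * (δ ^ 2 / ε ^ (2 * ((1 : ℝ) - α))) * C0norm f := by
  refine ⟨19 / (2 * cΓ), by positivity, 1, one_pos, ?_⟩
  intro X en1 en2 hG ε δ hε hε1 _ _ α hα hα1 _ f hf hfper s θ hx
  have hr : 0 < ε ^ ((1 : ℝ) - α) := Real.rpow_pos_of_pos hε _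
  have hεr : ε ≤ ε ^ ((1 : ℝ) - α) := by
    simpa using Real.rpow_le_rpow_of_exponent_ge hε hε1.le (by linarith : (1 : ℝ) - α ≤ 1)
  have hr2 : ε ^ (2 * ((1 : ℝ) - α)) = (ε ^ ((1 : ℝ) - α)) ^ 2 := by
    rw [mul_comm, Real.rpow_mul hε.le, Real.rpow_two]
  rw [hr2]
  refine norm_uReg_sub_uSB_le (s := s) hcΓ hr hε.le hεr hG.smooth.continuous hG.periodicX
    hG.no_self_intersect hf hfper ?_ hx
  rw [add_sub_cancel_left, norm_smul, norm_ePerp (hG.en1_unit s) (hG.en2_unit s) (hG.en1_en2 s),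
    mul_one, Real.norm_of_nonneg hr.le]
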